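/- Let Θ be a countable model with prior π whose density ratios are uniformly bounded by some v > 1, and let η with 1/2 ≤ η < 1 satisfy Σ_{θ∈Θ} π(θ)^η < ∞. Set C = (η/(1−η)) · (2 + 2 log v) and c_η = (1−η)/(1 + η(1−η)). Then for every b > 0 and every n ≥ 2, the Bayesian joint probability Π( (θ*, Z^n) : δ̄_n(θ*, Z^n) ≥ C · ( (log v) · n^{−b c_η} + 2b (log n)/n ) ) ≤ 2 (Σ_{θ∈Θ} π(θ)^η) · n^{−b c_η}. -/

import Mathlib

open MeasureTheory ENNReal

noncomputable section

/-- Unnormalized posterior weight of `θ` given the sample `z`. -/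
def postNum {Z : Type*} {Θ : Type*} (π : Θ → ℝ) (f : Θ → Z → ℝ) {n : ℕ}
    (z : Fin n → Z) (θ : Θ) : ℝ :=
  π θ * ∏ i, f θ (z i)

/-- The Bayesian posterior of `θ` given the sample `z`. -/
def post {Z : Type*} {Θ : Type*} (π : Θ → ℝ) (f : Θ → Z → ℝ) {n : ℕ}
    (z : Fin n → Z) (θ : Θ) : ℝ :=
  postNum π f z θ / ∑' θ', postNum π f z θ'

/-- The Bayes predictive density of a next outcome `x` given the sample `z`. -/
def pBayes {Z : Type*} {Θ : Type*} (π : Θ → ℝ) (f : Θ → Z → ℝ) {n : ℕ}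
    (z : Fin n → Z) (x : Z) : ℝ :=
  ∑' θ, post π f z θ * f θ x

/-- The expected next-step mixability gap `δ̄_n(θ*, z^n)`. -/
def deltaBar {Z : Type*} [MeasurableSpace Z] (ρ : Measure Z) {Θ : Type*}
    (π : Θ → ℝ) (f : Θ → Z → ℝ) {n : ℕ} (θstar : Θ) (z : Fin n → Z) : ℝ :=
  ∫ x, ((∑' θ, post π f z θ * (-Real.log (f θ x))) + Real.log (pBayes π f z x)) *
    f θstar x ∂ρ

/-- The Bayesian joint probability `Π` of an event `E` (which may depend on the
sampled parameter `θ*`): `Σ_{θ*} π(θ*) · P_{θ*}^{⊗n}(E θ*)`, where `P_{θ*}^{⊗n}` is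
the product measure on `Z^n` with density `∏_i f_{θ*}(z_i)` w.r.t. `ρ^{⊗n}`. -/
def jointProb {Z : Type*} [MeasurableSpace Z] (ρ : Measure Z) [SigmaFinite ρ]
    {Θ : Type*} (π : Θ → ℝ) (f : Θ → Z → ℝ) (n : ℕ)
    (E : Θ → Set (Fin n → Z)) : ℝ≥0∞ :=
  ∑' θstar, ENNReal.ofReal (π θstar) *
    ((Measure.pi fun _ : Fin n => ρ).withDensity
      fun z => ENNReal.ofReal (∏ i, f θstar (z i))) (E θstar)

/-- The pointwise integrand `q - p - p log (q / p)` of the Kullback–Leibler divergence of `p`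
from `q`, in its nonnegative form. -/
def klTerm (p q : ℝ) : ℝ := q - p - p * (Real.log q - Real.log p)

lemma klTerm_nonneg {p q : ℝ} (hp : 0 < p) (hq : 0 < q) : 0 ≤ klTerm p q := by
  have h := Real.log_le_sub_one_of_pos (div_pos hq hp)
  rw [Real.log_div hq.ne' hp.ne'] at h
  have h' := mul_le_mul_of_nonneg_left h hp.le
  rw [mul_sub p (q / p), mul_div_cancel₀ _ hp.ne', mul_sub] at h'
  unfold klTerm
  linarith

lemma klTerm_le {p q v : ℝ} (hp : 0 < p) (hq : 0 < q) (hv : 0 < v) (h : p ≤ v * q) :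
    klTerm p q ≤ q - p + Real.log v * p := by
  have h' := Real.log_le_log hp h
  rw [Real.log_mul hv.ne' hq.ne'] at h'
  unfold klTerm
  nlinarith

/-- Comparison of the Kullback–Leibler and squared Hellinger integrands, in the variable
`s = √(q / p)`. -/
lemma sq_sub_one_sub_two_log_le {s L : ℝ} (hs : 0 < s) (hL : 0 ≤ L)
    (hsL : -(2 * Real.log s) ≤ L) :
    s ^ 2 - 1 - 2 * Real.log s ≤ (2 + 2 * L) * (1 - s) ^ 2 := by
  rcases le_total 1 s with h1 | h1
  · have h := Real.le_log_one_add_of_nonneg (sub_nonneg.2 h1)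
    rw [add_sub_cancel, div_le_iff₀ (by linarith)] at h
    have : s ^ 2 - 1 - 2 * Real.log s ≤ 2 * (1 - s) ^ 2 := by
      by_contra! hc
      have h3 := mul_lt_mul_of_pos_right hc (show 0 < s + 1 by linarith)
      nlinarith [mul_nonneg (sub_nonneg.2 h1) (sq_nonneg (s - 1))]
    nlinarith [mul_nonneg hL (sq_nonneg (1 - s))]
  · set u := -Real.log s with hu
    have hu0 : 0 ≤ u := by
      have := Real.log_nonpos hs.le h1
      linarith
    have hsinh := Real.self_le_sinh_iff.2 hu0
    rw [Real.sinh_eq, hu, neg_neg, Real.exp_neg, Real.exp_log hs, ← hu] at hsinh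
    have hsinh' : 2 * u * s ≤ 1 - s ^ 2 := by
      have := mul_le_mul_of_nonneg_right hsinh (show 0 ≤ 2 * s by linarith)
      field_simp at this
      nlinarith
    have key : s ^ 2 - 1 + 2 * u ≤ (2 + 4 * u) * (1 - s) ^ 2 := by
      rcases le_total (2 * (1 - s) ^ 2) 1 with h2 | h2
      · have h3 := mul_le_mul_of_nonneg_right hsinh' (sub_nonneg.2 h2)
        by_contra! hc
        have h4 := mul_lt_mul_of_pos_right hc hs
        have h5 : 0 ≤ (1 - s) ^ 2 * (1 + 2 * s) := by positivity
        nlinarith [mul_nonneg (sub_nonneg.2 h1) h5]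
      · nlinarith [mul_nonneg (sub_nonneg.2 h1) (show 0 ≤ 3 - s by linarith),
          mul_nonneg hu0 (sub_nonneg.2 h2)]
    have hsL' : 2 * u ≤ L := by linarith
    nlinarith [mul_nonneg (sub_nonneg.2 hsL') (sq_nonneg (1 - s))]

/-- The Kullback–Leibler integrand is dominated by the Tsallis integrand of order `η ≥ 1 / 2`. -/
lemma klTerm_le_tsallis {p q v η : ℝ} (hp : 0 < p) (hq : 0 < q) (hv : 1 < v) (h : p ≤ v * q)
    (hη₁ : 1 / 2 ≤ η) (hη₂ : η < 1) :
    klTerm p q ≤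
      (2 + 2 * Real.log v) / (1 - η) * (η * q + (1 - η) * p - q ^ η * p ^ (1 - η)) := by
  have hL : 0 ≤ Real.log v := (Real.log_pos hv).le
  set P := √p with hP
  set Q := √q with hQ
  have hP0 : 0 < P := Real.sqrt_pos.2 hp
  have hQ0 : 0 < Q := Real.sqrt_pos.2 hq
  have hPP : P ^ 2 = p := Real.sq_sqrt hp.le
  have hQQ : Q ^ 2 = q := Real.sq_sqrt hq.le
  have hlog : Real.log q - Real.log p = 2 * Real.log (Q / P) := by
    rw [Real.log_div hQ0.ne' hP0.ne', ← hPP, ← hQQ, Real.log_pow, Real.log_pow]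
    push_cast; ring
  have hsL : -(2 * Real.log (Q / P)) ≤ Real.log v := by
    have h' := Real.log_le_log hp h
    rw [Real.log_mul (by linarith) hq.ne'] at h'
    linarith
  have h1 := sq_sub_one_sub_two_log_le (div_pos hQ0 hP0) hL hsL
  have h2 : klTerm p q ≤ (2 + 2 * Real.log v) * (P - Q) ^ 2 := by
    have := mul_le_mul_of_nonneg_right h1 hp.le
    unfold klTerm
    rw [hlog]
    have e1 : ((Q / P) ^ 2 - 1 - 2 * Real.log (Q / P)) * p
        = q - p - p * (2 * Real.log (Q / P)) := by
      rw [div_pow, hPP, hQQ]; field_simp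
    have e2 : (2 + 2 * Real.log v) * (1 - Q / P) ^ 2 * p
        = (2 + 2 * Real.log v) * (P - Q) ^ 2 := by
      rw [← hPP]; field_simp
    linarith
  have h3 : q ^ η * p ^ (1 - η) ≤ (2 * (1 - η)) * (P * Q) + (2 * η - 1) * q := by
    have := Real.geom_mean_le_arith_mean2_weighted (w₁ := 2 * (1 - η)) (w₂ := 2 * η - 1)
      (p₁ := P * Q) (p₂ := q) (by linarith) (by linarith) (by positivity) hq.le (by ring)
    refine le_trans (le_of_eq ?_) this
    rw [Real.mul_rpow hP0.le hQ0.le, hP, hQ, Real.sqrt_eq_rpow, Real.sqrt_eq_rpow,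
      ← Real.rpow_mul hp.le, ← Real.rpow_mul hq.le, mul_assoc, ← Real.rpow_add hq,
      mul_comm]
    congr 2 <;> ring
  refine h2.trans ?_
  rw [div_mul_eq_mul_div, mul_div_assoc]
  refine mul_le_mul_of_nonneg_left ?_ (by linarith)
  rw [le_div_iff₀ (by linarith)]
  nlinarith

/-- The affinity `∫ q ^ η p ^ (1 - η)` of two densities. -/
def affinity {Z : Type*} [MeasurableSpace Z] (ρ : Measure Z) (η : ℝ) (p q : Z → ℝ) : ℝ :=
  ∫ x, q x ^ η * p x ^ (1 - η) ∂ρ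

section Densities

variable {Z : Type*} [MeasurableSpace Z] {ρ : Measure Z} {p q : Z → ℝ} {v η : ℝ}

lemma integrable_affinity (hpm : Measurable p) (hqm : Measurable q)
    (hp : ∀ x, 0 < p x) (hq : ∀ x, 0 < q x) (hpi : Integrable p ρ) (hqi : Integrable q ρ)
    (hη₁ : 0 ≤ η) (hη₂ : η ≤ 1) :
    Integrable (fun x => q x ^ η * p x ^ (1 - η)) ρ := by
  refine ((hqi.const_mul η).add (hpi.const_mul (1 - η))).mono' (by fun_prop) (.of_forall fun x => ?_)
  have h1 := hp x
  have h2 := hq x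
  rw [Real.norm_of_nonneg (by positivity)]
  exact Real.geom_mean_le_arith_mean2_weighted hη₁ (by linarith) h2.le h1.le (by ring)

lemma integrable_klTerm (hpm : Measurable p) (hqm : Measurable q)
    (hp : ∀ x, 0 < p x) (hq : ∀ x, 0 < q x) (hpi : Integrable p ρ) (hqi : Integrable q ρ)
    (hv : 0 < v) (h : ∀ x, p x ≤ v * q x) :
    Integrable (fun x => klTerm (p x) (q x)) ρ := by
  refine ((hqi.sub hpi).add (hpi.const_mul (Real.log v))).mono' ?_ (.of_forall fun x => ?_)
  · unfold klTerm
    fun_prop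
  · rw [Real.norm_of_nonneg (klTerm_nonneg (hp x) (hq x))]
    exact klTerm_le (hp x) (hq x) hv (h x)

lemma integral_klTerm_le_log (hpm : Measurable p) (hqm : Measurable q)
    (hp : ∀ x, 0 < p x) (hq : ∀ x, 0 < q x) (hpi : Integrable p ρ) (hqi : Integrable q ρ)
    (hp1 : ∫ x, p x ∂ρ = 1) (hq1 : ∫ x, q x ∂ρ = 1)
    (hv : 0 < v) (h : ∀ x, p x ≤ v * q x) :
    ∫ x, klTerm (p x) (q x) ∂ρ ≤ Real.log v := by
  have := integral_mono (integrable_klTerm hpm hqm hp hq hpi hqi hv h)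
    ((hqi.sub hpi).add (hpi.const_mul (Real.log v)))
    fun x => klTerm_le (hp x) (hq x) hv (h x)
  refine this.trans (le_of_eq ?_)
  rw [integral_add' (hqi.sub hpi) (hpi.const_mul _), integral_sub' hqi hpi, integral_const_mul,
    hp1, hq1]
  ring

lemma integral_klTerm_le_affinity (hpm : Measurable p) (hqm : Measurable q)
    (hp : ∀ x, 0 < p x) (hq : ∀ x, 0 < q x) (hpi : Integrable p ρ) (hqi : Integrable q ρ)
    (hp1 : ∫ x, p x ∂ρ = 1) (hq1 : ∫ x, q x ∂ρ = 1)
    (hv : 1 < v) (h : ∀ x, p x ≤ v * q x) (hη₁ : 1 / 2 ≤ η) (hη₂ : η < 1) :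
    ∫ x, klTerm (p x) (q x) ∂ρ ≤ (2 + 2 * Real.log v) / (1 - η) * (1 - affinity ρ η p q) := by
  have hA := integrable_affinity hpm hqm hp hq hpi hqi (by linarith : 0 ≤ η) hη₂.le
  have hS := (hqi.const_mul η).add (hpi.const_mul (1 - η))
  have := integral_mono (integrable_klTerm hpm hqm hp hq hpi hqi (by linarith) h)
    ((hS.sub hA).const_mul ((2 + 2 * Real.log v) / (1 - η)))
    fun x => klTerm_le_tsallis (hp x) (hq x) hv (h x) hη₁ hη₂
  refine this.trans (le_of_eq ?_)
  rw [integral_const_mul, integral_sub' hS hA, integral_add' (hqi.const_mul η) (hpi.const_mul _),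
    integral_const_mul, integral_const_mul, hp1, hq1, affinity]
  ring

end Densities

section Posterior

variable {Z : Type*} {Θ : Type*} {f : Θ → Z → ℝ} {π : Θ → ℝ} {v : ℝ} {n : ℕ}

lemma postNum_pos (hf_pos : ∀ θ x, 0 < f θ x) (hπ_pos : ∀ θ, 0 < π θ) (z : Fin n → Z) (θ : Θ) :
    0 < postNum π f z θ :=
  mul_pos (hπ_pos θ) (Finset.prod_pos fun i _ => hf_pos θ (z i))

lemma summable_postNum (hf_pos : ∀ θ x, 0 < f θ x) (hπ_pos : ∀ θ, 0 < π θ) (hπ : Summable π)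
    (hratio : ∀ (x : Z) (θ θ' : Θ), f θ x ≤ v * f θ' x) (z : Fin n → Z) :
    Summable (postNum π f z) := by
  rcases isEmpty_or_nonempty Θ with hΘ | ⟨⟨θ₀⟩⟩
  · exact summable_empty
  refine (hπ.mul_right (∏ i, v * f θ₀ (z i))).of_nonneg_of_le
    (fun θ => (postNum_pos hf_pos hπ_pos z θ).le) fun θ => ?_
  exact mul_le_mul_of_nonneg_left
    (Finset.prod_le_prod (fun i _ => (hf_pos θ _).le) fun i _ => hratio _ _ _) (hπ_pos θ).le

lemma tsum_postNum_pos [Nonempty Θ] (hf_pos : ∀ θ x, 0 < f θ x) (hπ_pos : ∀ θ, 0 < π θ)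
    (hπ : Summable π) (hratio : ∀ (x : Z) (θ θ' : Θ), f θ x ≤ v * f θ' x) (z : Fin n → Z) :
    0 < ∑' θ, postNum π f z θ :=
  (summable_postNum hf_pos hπ_pos hπ hratio z).tsum_pos
    (fun θ => (postNum_pos hf_pos hπ_pos z θ).le) (Classical.arbitrary Θ)
    (postNum_pos hf_pos hπ_pos z _)

lemma post_pos [Nonempty Θ] (hf_pos : ∀ θ x, 0 < f θ x) (hπ_pos : ∀ θ, 0 < π θ)
    (hπ : Summable π) (hratio : ∀ (x : Z) (θ θ' : Θ), f θ x ≤ v * f θ' x) (z : Fin n → Z)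
    (θ : Θ) : 0 < post π f z θ :=
  div_pos (postNum_pos hf_pos hπ_pos z θ) (tsum_postNum_pos hf_pos hπ_pos hπ hratio z)

lemma hasSum_post [Nonempty Θ] (hf_pos : ∀ θ x, 0 < f θ x) (hπ_pos : ∀ θ, 0 < π θ)
    (hπ : Summable π) (hratio : ∀ (x : Z) (θ θ' : Θ), f θ x ≤ v * f θ' x) (z : Fin n → Z) :
    HasSum (post π f z) 1 := by
  have h := (summable_postNum hf_pos hπ_pos hπ hratio z).hasSum.div_const
    (∑' θ, postNum π f z θ)
  rwa [div_self (tsum_postNum_pos hf_pos hπ_pos hπ hratio z).ne'] at h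

lemma post_le_div (hf_pos : ∀ θ x, 0 < f θ x) (hπ_pos : ∀ θ, 0 < π θ)
    (hπ : Summable π) (hratio : ∀ (x : Z) (θ θ' : Θ), f θ x ≤ v * f θ' x) (z : Fin n → Z)
    (θ θ' : Θ) : post π f z θ ≤ postNum π f z θ / postNum π f z θ' :=
  div_le_div_of_nonneg_left (postNum_pos hf_pos hπ_pos z θ).le (postNum_pos hf_pos hπ_pos z θ')
    ((summable_postNum hf_pos hπ_pos hπ hratio z).le_tsum θ'
      fun θ _ => (postNum_pos hf_pos hπ_pos z θ).le)

/-- The mixability gap integrand is dominated by the posterior mean of the Kullback–Leibler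
integrands. -/
lemma gap_mul_le_tsum_klTerm (hf_pos : ∀ θ x, 0 < f θ x) (hπ_pos : ∀ θ, 0 < π θ)
    (hπ : Summable π) (hv : 1 < v)
    (hratio : ∀ (x : Z) (θ θ' : Θ), f θ x ≤ v * f θ' x) (z : Fin n → Z) (θs : Θ) (x : Z) :
    ((∑' θ, post π f z θ * (-Real.log (f θ x))) + Real.log (pBayes π f z x)) * f θs x ≤
      ∑' θ, post π f z θ * klTerm (f θs x) (f θ x) := by
  have : Nonempty Θ := ⟨θs⟩
  have hv0 : 0 < v := by linarith
  have hw := hasSum_post hf_pos hπ_pos hπ hratio z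
  have hw0 := fun θ => (post_pos hf_pos hπ_pos hπ hratio z θ).le
  have hs := hf_pos θs x
  have hB : Summable fun θ => post π f z θ * f θ x :=
    (hw.summable.mul_right (v * f θs x)).of_nonneg_of_le
      (fun θ => mul_nonneg (hw0 θ) (hf_pos θ x).le)
      fun θ => mul_le_mul_of_nonneg_left (hratio _ _ _) (hw0 θ)
  have hBpos : 0 < pBayes π f z x :=
    hB.tsum_pos (fun θ => mul_nonneg (hw0 θ) (hf_pos θ x).le) θs
      (mul_pos (post_pos hf_pos hπ_pos hπ hratio z θs) hs)
  have hlog : Summable fun θ => post π f z θ * (-Real.log (f θ x)) := by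
    refine (hw.summable.mul_right (Real.log v + |Real.log (f θs x)|)).of_norm_bounded
      fun θ => ?_
    rw [norm_mul, Real.norm_of_nonneg (hw0 θ), norm_neg, Real.norm_eq_abs]
    refine mul_le_mul_of_nonneg_left ?_ (hw0 θ)
    have h1 := Real.log_le_log (hf_pos θ x) (hratio x θ θs)
    have h2 := Real.log_le_log hs (hratio x θs θ)
    rw [Real.log_mul hv0.ne' (hf_pos _ x).ne'] at h1 h2
    have h3 := abs_le.1 (le_refl |Real.log (f θs x)|)
    exact abs_le.2 ⟨by linarith, by linarith⟩
  have hsum := ((hB.hasSum.sub (hw.mul_right (f θs x))).add (hlog.hasSum.mul_right (f θs x))).add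
    (hw.mul_right (f θs x * Real.log (f θs x)))
  have heq : ∑' θ, post π f z θ * klTerm (f θs x) (f θ x) = _ :=
    (hsum.congr_fun fun θ => by unfold klTerm; ring).tsum_eq
  rw [heq]
  have h := klTerm_nonneg hs hBpos
  unfold klTerm at h
  change _ ≤ pBayes π f z x - _ + _ + _
  linarith

lemma deltaBar_le_tsum [MeasurableSpace Z] {ρ : Measure Z} [Countable Θ]
    (hf_meas : ∀ θ, Measurable (f θ)) (hf_pos : ∀ θ x, 0 < f θ x)
    (hf_int : ∀ θ, ∫ x, f θ x ∂ρ = 1) (hπ_pos : ∀ θ, 0 < π θ)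
    (hπ : Summable π) (hv : 1 < v)
    (hratio : ∀ (x : Z) (θ θ' : Θ), f θ x ≤ v * f θ' x) (z : Fin n → Z) (θs : Θ) :
    Summable (fun θ => post π f z θ * ∫ x, klTerm (f θs x) (f θ x) ∂ρ) ∧
    deltaBar ρ π f θs z ≤ ∑' θ, post π f z θ * ∫ x, klTerm (f θs x) (f θ x) ∂ρ := by
  have : Nonempty Θ := ⟨θs⟩
  have hv0 : 0 < v := by linarith
  have hi : ∀ θ, Integrable (f θ) ρ := fun θ => .of_integral_ne_zero (by simp [hf_int θ])
  have hw := hasSum_post hf_pos hπ_pos hπ hratio z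
  have hw0 := fun θ => (post_pos hf_pos hπ_pos hπ hratio z θ).le
  have hk0 : ∀ θ x, 0 ≤ klTerm (f θs x) (f θ x) := fun θ x =>
    klTerm_nonneg (hf_pos θs x) (hf_pos θ x)
  have hkle : ∀ θ x, klTerm (f θs x) (f θ x) ≤ (v + Real.log v) * f θs x := fun θ x => by
    have := klTerm_le (hf_pos θs x) (hf_pos θ x) hv0 (hratio x θs θ)
    have := hratio x θ θs
    have := hf_pos θs x
    linarith
  have hki : ∀ θ, Integrable (fun x => klTerm (f θs x) (f θ x)) ρ := fun θ =>
    integrable_klTerm (hf_meas _) (hf_meas _) (hf_pos _) (hf_pos _) (hi _) (hi _) hv0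
      fun x => hratio x _ _
  have hsum : Summable (fun θ => post π f z θ * ∫ x, klTerm (f θs x) (f θ x) ∂ρ) :=
    (hw.summable.mul_right (Real.log v)).of_nonneg_of_le
      (fun θ => mul_nonneg (hw0 θ) (integral_nonneg (hk0 θ)))
      fun θ => mul_le_mul_of_nonneg_left
        (integral_klTerm_le_log (hf_meas _) (hf_meas _) (hf_pos _) (hf_pos _) (hi _) (hi _)
          (hf_int _) (hf_int _) hv0 fun x => hratio x _ _) (hw0 θ)
  refine ⟨hsum, ?_⟩
  have hbound : ∀ x θ, post π f z θ * klTerm (f θs x) (f θ x) ≤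
      post π f z θ * ((v + Real.log v) * f θs x) := fun x θ =>
    mul_le_mul_of_nonneg_left (hkle θ x) (hw0 θ)
  have hpt : ∀ x, Summable fun θ => post π f z θ * klTerm (f θs x) (f θ x) := fun x =>
    (hw.summable.mul_right _).of_nonneg_of_le (fun θ => mul_nonneg (hw0 θ) (hk0 θ x)) (hbound x)
  have hswap := integral_tsum_of_summable_integral_norm (μ := ρ)
    (F := fun θ x => post π f z θ * klTerm (f θs x) (f θ x)) (fun θ => (hki θ).const_mul _)
    (by
      refine hsum.congr fun θ => ?_
      rw [← integral_const_mul]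
      exact integral_congr_ae (.of_forall fun x =>
        (Real.norm_of_nonneg (mul_nonneg (hw0 θ) (hk0 θ x))).symm))
  simp only [integral_const_mul] at hswap
  rw [hswap]
  have hgi : Integrable (fun x => ∑' θ, post π f z θ * klTerm (f θs x) (f θ x)) ρ := by
    refine ((hi θs).const_mul (v + Real.log v)).mono' ?_ (.of_forall fun x => ?_)
    · refine (Measurable.tsum fun θ => ?_).aestronglyMeasurable
      have := hf_meas θ
      have := hf_meas θs
      unfold klTerm
      fun_prop
    · rw [Real.norm_of_nonneg (tsum_nonneg fun θ => mul_nonneg (hw0 θ) (hk0 θ x))]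
      simpa using hasSum_le (hbound x) (hpt x).hasSum (hw.mul_right _)
  have hle := gap_mul_le_tsum_klTerm hf_pos hπ_pos hπ hv hratio z θs
  by_cases hgap : Integrable (fun x => ((∑' θ, post π f z θ * (-Real.log (f θ x))) +
      Real.log (pBayes π f z x)) * f θs x) ρ
  · exact integral_mono hgap hgi hle
  · rw [deltaBar, integral_undef hgap]
    exact integral_nonneg fun x => tsum_nonneg fun θ => mul_nonneg (hw0 θ) (hk0 θ x)

/-- If the posterior mass of a set `F` is at most `t` and all parameters outside `F` have
Kullback–Leibler divergence at most `κ`, then the expected gap is at most `t log v + κ`. -/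
lemma deltaBar_le_of_mass [MeasurableSpace Z] {ρ : Measure Z} [Countable Θ]
    (hf_meas : ∀ θ, Measurable (f θ)) (hf_pos : ∀ θ x, 0 < f θ x)
    (hf_int : ∀ θ, ∫ x, f θ x ∂ρ = 1) (hπ_pos : ∀ θ, 0 < π θ)
    (hπ : Summable π) (hv : 1 < v)
    (hratio : ∀ (x : Z) (θ θ' : Θ), f θ x ≤ v * f θ' x) (z : Fin n → Z) (θs : Θ)
    {F : Set Θ} {t κ : ℝ} (hκ : 0 ≤ κ)
    (hF : ∀ θ ∉ F, ∫ x, klTerm (f θs x) (f θ x) ∂ρ ≤ κ)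
    (ht : ∑' θ, F.indicator (post π f z) θ ≤ t) :
    deltaBar ρ π f θs z ≤ Real.log v * t + κ := by
  have : Nonempty Θ := ⟨θs⟩
  have hv0 : 0 < v := by linarith
  have hi : ∀ θ, Integrable (f θ) ρ := fun θ => .of_integral_ne_zero (by simp [hf_int θ])
  have hw := hasSum_post hf_pos hπ_pos hπ hratio z
  have hw0 := fun θ => (post_pos hf_pos hπ_pos hπ hratio z θ).le
  obtain ⟨hsum, hle⟩ := deltaBar_le_tsum (ρ := ρ) hf_meas hf_pos hf_int hπ_pos hπ hv hratio z θs
  have hFs := (hw.summable.indicator F).hasSum.mul_left (Real.log v)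
  have h := hasSum_le (fun θ => ?_) hsum.hasSum (hFs.add (hw.mul_right κ))
  · have := mul_le_mul_of_nonneg_left ht (Real.log_pos hv).le
    linarith
  · by_cases hθ : θ ∈ F
    · rw [Set.indicator_of_mem hθ]
      have h1 := mul_le_mul_of_nonneg_left (integral_klTerm_le_log (hf_meas θs) (hf_meas θ)
        (hf_pos _) (hf_pos _) (hi _) (hi _)
          (hf_int _) (hf_int _) hv0 fun x => hratio x _ _) (hw0 θ)
      have h2 := mul_nonneg (hw0 θ) hκ
      linarith
    · rw [Set.indicator_of_notMem hθ]
      have h1 := mul_le_mul_of_nonneg_left (hF θ hθ) (hw0 θ)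
      linarith

lemma measurable_postNum [MeasurableSpace Z] (hf_meas : ∀ θ, Measurable (f θ)) (θ : Θ) :
    Measurable fun z : Fin n → Z => postNum π f z θ := by
  have := hf_meas θ
  unfold postNum
  fun_prop

lemma lintegral_postNum_ratio_rpow [MeasurableSpace Z] {ρ : Measure Z} [SigmaFinite ρ] {η : ℝ}
    (hf_meas : ∀ θ, Measurable (f θ)) (hf_pos : ∀ θ x, 0 < f θ x)
    (hf_int : ∀ θ, ∫ x, f θ x ∂ρ = 1) (hπ_pos : ∀ θ, 0 < π θ)
    (hη₀ : 0 ≤ η) (hη₁ : η ≤ 1) (θ θs : Θ) :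
    ∫⁻ z : Fin n → Z, ENNReal.ofReal (∏ i, f θs (z i)) *
        ENNReal.ofReal ((postNum π f z θ / postNum π f z θs) ^ η) ∂(Measure.pi fun _ => ρ) =
      ENNReal.ofReal ((π θ / π θs) ^ η * affinity ρ η (f θs) (f θ) ^ n) := by
  have hi : ∀ θ, Integrable (f θ) ρ := fun θ => .of_integral_ne_zero (by simp [hf_int θ])
  have hA := integrable_affinity (hf_meas θs) (hf_meas θ) (hf_pos θs) (hf_pos θ) (hi θs) (hi θ)
    hη₀ hη₁
  have hpt : ∀ z : Fin n → Z, (∏ i, f θs (z i)) *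
      (postNum π f z θ / postNum π f z θs) ^ η =
      (π θ / π θs) ^ η * ∏ i, (f θ (z i) ^ η * f θs (z i) ^ (1 - η)) := fun z => by
    have h1 : 0 < ∏ i, f θs (z i) := Finset.prod_pos fun i _ => hf_pos _ _
    have h2 : 0 < ∏ i, f θ (z i) := Finset.prod_pos fun i _ => hf_pos _ _
    have h3 := (div_pos (hπ_pos θ) (hπ_pos θs)).le
    rw [Finset.prod_mul_distrib, Real.finsetProd_rpow _ _ fun i _ => (hf_pos _ _).le,
      Real.finsetProd_rpow _ _ fun i _ => (hf_pos _ _).le, postNum, postNum, mul_div_mul_comm,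
      Real.mul_rpow h3 (div_pos h2 h1).le, Real.div_rpow h2.le h1.le, Real.rpow_sub h1,
      Real.rpow_one]
    ring
  have hint : Integrable (fun z : Fin n → Z =>
      (π θ / π θs) ^ η * ∏ i, (f θ (z i) ^ η * f θs (z i) ^ (1 - η)))
      (Measure.pi fun _ => ρ) :=
    (Integrable.fintype_prod (f := fun _ : Fin n => fun x => f θ x ^ η * f θs x ^ (1 - η))
      fun _ => hA).const_mul _
  calc _ = ∫⁻ z : Fin n → Z, ENNReal.ofReal
        ((π θ / π θs) ^ η * ∏ i, (f θ (z i) ^ η * f θs (z i) ^ (1 - η)))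
        ∂(Measure.pi fun _ => ρ) := lintegral_congr fun z => by
          rw [← hpt, ENNReal.ofReal_mul (Finset.prod_nonneg fun i _ => (hf_pos _ _).le)]
    _ = _ := by
      rw [← ofReal_integral_eq_lintegral_ofReal hint (.of_forall fun z => ?_),
        integral_const_mul,
        integral_fintype_prod_eq_pow (ι := Fin n)
          (f := fun x => f θ x ^ η * f θs x ^ (1 - η)), Fintype.card_fin, affinity]
      exact mul_nonneg (Real.rpow_nonneg (div_pos (hπ_pos _) (hπ_pos _)).le _)
        (Finset.prod_nonneg fun i _ =>
          mul_nonneg (Real.rpow_nonneg (hf_pos _ _).le _) (Real.rpow_nonneg (hf_pos _ _).le _))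

/-- A nonnegative family with sum at least `1` keeps this property when raised to a power
`η ∈ (0, 1]`. -/
lemma one_le_tsum_ofReal_rpow {ι : Type*} {y : ι → ℝ} {η : ℝ} (hy : ∀ i, 0 ≤ y i)
    (hη₀ : 0 ≤ η) (hη₁ : η ≤ 1) (h : 1 ≤ ∑' i, ENNReal.ofReal (y i)) :
    1 ≤ ∑' i, ENNReal.ofReal (y i ^ η) := by
  by_cases hex : ∃ i, 1 ≤ y i
  · obtain ⟨i, hi⟩ := hex
    refine le_trans ?_ (ENNReal.le_tsum i)
    rw [ENNReal.one_le_ofReal]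
    exact Real.one_le_rpow hi hη₀
  · push Not at hex
    exact h.trans (ENNReal.tsum_le_tsum fun i =>
      ENNReal.ofReal_le_ofReal (Real.self_le_rpow_of_le_one (hy i) (hex i).le hη₁))

/-- Under `θs`, the posterior mass of a set of parameters having small affinity to `θs` is small
with high probability. -/
lemma measure_mass_ge_le [MeasurableSpace Z] {ρ : Measure Z} [SigmaFinite ρ] [Countable Θ] {η : ℝ}
    (hf_meas : ∀ θ, Measurable (f θ)) (hf_pos : ∀ θ x, 0 < f θ x)
    (hf_int : ∀ θ, ∫ x, f θ x ∂ρ = 1) (hπ_pos : ∀ θ, 0 < π θ)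
    (hπ : Summable π) (hratio : ∀ (x : Z) (θ θ' : Θ), f θ x ≤ v * f θ' x)
    (hη₀ : 0 ≤ η) (hη₁ : η ≤ 1) (hsum : Summable fun θ => π θ ^ η) (θs : Θ)
    {F : Set Θ} {t B : ℝ} (ht : 0 < t) (hB : 0 ≤ B)
    (hF : ∀ θ ∈ F, affinity ρ η (f θs) (f θ) ^ n ≤ B) :
    ((Measure.pi fun _ : Fin n => ρ).withDensity
        fun z => ENNReal.ofReal (∏ i, f θs (z i)))
        {z | t ≤ ∑' θ, F.indicator (post π f z) θ} ≤
      ENNReal.ofReal (t ^ (-η) * π θs ^ (-η) * B * ∑' θ, π θ ^ η) := by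
  have : Nonempty Θ := ⟨θs⟩
  have hr0 : ∀ (z : Fin n → Z) θ, 0 ≤ postNum π f z θ / postNum π f z θs := fun z θ =>
    (div_pos (postNum_pos hf_pos hπ_pos z _) (postNum_pos hf_pos hπ_pos z _)).le
  set G : (Fin n → Z) → ℝ≥0∞ := fun z => ∑' θ : F,
    ENNReal.ofReal (t ^ (-η)) *
      ENNReal.ofReal ((postNum π f z θ / postNum π f z θs) ^ η) with hG
  have hterm : ∀ θ, Measurable fun z : Fin n → Z =>
      ENNReal.ofReal ((postNum π f z θ / postNum π f z θs) ^ η) := fun θ => by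
    have := measurable_postNum (π := π) (n := n) hf_meas θ
    have := measurable_postNum (π := π) (n := n) hf_meas θs
    fun_prop
  have hdens : Measurable fun z : Fin n → Z => ENNReal.ofReal (∏ i, f θs (z i)) := by
    have := hf_meas θs
    fun_prop
  have hGm : Measurable G := Measurable.tsum fun θ => (hterm θ).const_mul _
  have hsub : {z : Fin n → Z | t ≤ ∑' θ, F.indicator (post π f z) θ} ⊆ {z | 1 ≤ G z} := by
    intro z hz
    have hw := (hasSum_post hf_pos hπ_pos hπ hratio z).summable
    have hw0 := fun θ => (post_pos hf_pos hπ_pos hπ hratio z θ).le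
    have h1 : 1 ≤ ∑' θ : F, ENNReal.ofReal (t⁻¹ * (postNum π f z θ / postNum π f z θs)) := by
      have h2 : (1 : ℝ) ≤ ∑' θ : F, t⁻¹ * post π f z θ := by
        rw [tsum_mul_left, tsum_subtype F (post π f z), inv_mul_eq_div, one_le_div ht]
        exact hz
      rw [← ENNReal.one_le_ofReal, ENNReal.ofReal_tsum_of_nonneg
        (fun θ : F => mul_nonneg (inv_pos.2 ht).le (hw0 θ)) ((hw.subtype F).mul_left _)] at h2
      exact h2.trans (ENNReal.tsum_le_tsum fun θ => ENNReal.ofReal_le_ofReal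
        (mul_le_mul_of_nonneg_left (post_le_div hf_pos hπ_pos hπ hratio z θ θs)
          (inv_pos.2 ht).le))
    refine (one_le_tsum_ofReal_rpow (fun θ : F => mul_nonneg (inv_pos.2 ht).le (hr0 z θ)) hη₀ hη₁
      h1).trans (le_of_eq (tsum_congr fun θ : F => ?_))
    rw [Real.mul_rpow (inv_pos.2 ht).le (hr0 z θ), ENNReal.ofReal_mul (by positivity),
      Real.inv_rpow ht.le, Real.rpow_neg ht.le]
  calc _ ≤ _ := measure_mono hsub
    _ ≤ ∫⁻ z, G z ∂((Measure.pi fun _ : Fin n => ρ).withDensity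
        fun z => ENNReal.ofReal (∏ i, f θs (z i))) := by
      simpa using mul_meas_ge_le_lintegral hGm 1
    _ = ∑' θ : F, ENNReal.ofReal (t ^ (-η)) *
        ENNReal.ofReal ((π θ / π θs) ^ η * affinity ρ η (f θs) (f θ) ^ n) := by
      rw [lintegral_withDensity_eq_lintegral_mul _ hdens hGm]
      simp only [hG, Pi.mul_apply, ← ENNReal.tsum_mul_left]
      rw [lintegral_tsum]
      swap
      · exact fun θ => (hdens.mul ((hterm θ).const_mul _)).aemeasurable
      refine tsum_congr fun θ => ?_
      simp only [mul_left_comm _ (ENNReal.ofReal (t ^ (-η)))]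
      rw [lintegral_const_mul' _ _ ENNReal.ofReal_ne_top,
        lintegral_postNum_ratio_rpow hf_meas hf_pos hf_int hπ_pos hη₀ hη₁]
    _ ≤ ∑' θ : F, ENNReal.ofReal (t ^ (-η) * π θs ^ (-η) * B * π θ ^ η) := by
      refine ENNReal.tsum_le_tsum fun θ => ?_
      have h1 := (hπ_pos θs)
      have h2 := (hπ_pos θ)
      rw [← ENNReal.ofReal_mul (by positivity)]
      refine ENNReal.ofReal_le_ofReal ?_
      rw [Real.div_rpow h2.le h1.le, div_eq_mul_inv, ← Real.rpow_neg h1.le]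
      have := mul_le_mul_of_nonneg_left (hF θ θ.2)
        (show 0 ≤ t ^ (-η) * (π θ ^ η * π θs ^ (-η)) by positivity)
      linarith
    _ ≤ ∑' θ, ENNReal.ofReal (t ^ (-η) * π θs ^ (-η) * B * π θ ^ η) :=
      ENNReal.tsum_comp_le_tsum_of_injective Subtype.val_injective _
    _ = _ := by
      have h1 := (hπ_pos θs)
      rw [← tsum_mul_left, ENNReal.ofReal_tsum_of_nonneg (fun θ => ?_) (hsum.mul_left _)]
      have h2 := (hπ_pos θ)
      positivity

/-- If the expected gap is large, then the posterior mass of the parameters having small affinity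
to `θs` is large. -/
lemma mass_gt_of_deltaBar_ge [MeasurableSpace Z] {ρ : Measure Z} [Countable Θ] {η : ℝ}
    (hf_meas : ∀ θ, Measurable (f θ)) (hf_pos : ∀ θ x, 0 < f θ x)
    (hf_int : ∀ θ, ∫ x, f θ x ∂ρ = 1) (hπ_pos : ∀ θ, 0 < π θ)
    (hπ : Summable π) (hv : 1 < v)
    (hratio : ∀ (x : Z) (θ θ' : Θ), f θ x ≤ v * f θ' x)
    (hη₁ : 1 / 2 ≤ η) (hη₂ : η < 1) {b t : ℝ} (hb : 0 < b) (ht : 0 < t) (hn : 2 ≤ n)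
    (z : Fin n → Z) (θs : Θ)
    (h : (η / (1 - η)) * (2 + 2 * Real.log v) *
      (Real.log v * t + 2 * b * Real.log n / n) ≤ deltaBar ρ π f θs z) :
    t ≤ ∑' θ, {θ | affinity ρ η (f θs) (f θ) ^ n ≤ (n : ℝ) ^ (-b)}.indicator
      (post π f z) θ := by
  have hi : ∀ θ, Integrable (f θ) ρ := fun θ => .of_integral_ne_zero (by simp [hf_int θ])
  have hL : 0 < Real.log v := Real.log_pos hv
  have hn0 : (0 : ℝ) < n := by positivity
  have hη : 0 < 1 - η := by linarith
  have hlogn : 0 < Real.log n := Real.log_pos (by exact_mod_cast hn)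
  set κ := (2 + 2 * Real.log v) / (1 - η) * (b * Real.log n / n) with hκ
  have hκ0 : 0 < κ := by positivity
  by_contra! hlt
  have hle := deltaBar_le_of_mass (ρ := ρ) hf_meas hf_pos hf_int hπ_pos hπ hv hratio z θs
    (κ := κ) hκ0.le (fun θ hθ => ?_) hlt.le
  · have h1 : (η / (1 - η)) * (2 + 2 * Real.log v) * (Real.log v * t + 2 * b * Real.log n / n)
        = (η / (1 - η)) * (2 + 2 * Real.log v) * (Real.log v * t) + 2 * η * κ := by
      rw [hκ]; field_simp
    have h2 : 1 ≤ η / (1 - η) := (one_le_div hη).2 (by linarith)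
    have h3 : 2 + 2 * Real.log v ≤ (η / (1 - η)) * (2 + 2 * Real.log v) :=
      le_mul_of_one_le_left (by positivity) h2
    have h4 : 0 < Real.log v * t := by positivity
    nlinarith [mul_nonneg (show 0 ≤ 2 * η - 1 by linarith) hκ0.le]
  · rw [Set.mem_ofPred_eq, not_le] at hθ
    refine (integral_klTerm_le_affinity (hf_meas θs) (hf_meas θ) (hf_pos _) (hf_pos _)
      (hi _) (hi _) (hf_int _) (hf_int _) hv (fun x => hratio x _ _) hη₁ hη₂).trans ?_
    refine mul_le_mul_of_nonneg_left ?_ (by positivity)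
    set A := affinity ρ η (f θs) (f θ)
    have hA0 : 0 ≤ A := integral_nonneg fun x =>
      mul_nonneg (Real.rpow_nonneg (hf_pos _ _).le _) (Real.rpow_nonneg (hf_pos _ _).le _)
    have hApos : 0 < A := hA0.lt_of_ne' fun h0 => by
      rw [h0, zero_pow (by omega)] at hθ
      exact absurd hθ (not_lt.2 (by positivity))
    have h1 := Real.log_le_log (by positivity) hθ.le
    rw [Real.log_rpow hn0, Real.log_pow] at h1
    have h2 := Real.log_le_sub_one_of_pos hApos
    rw [le_div_iff₀ hn0]
    nlinarith

lemma lintegral_prod_density [MeasurableSpace Z] {ρ : Measure Z} [SigmaFinite ρ]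
    (hf_pos : ∀ θ x, 0 < f θ x) (hf_int : ∀ θ, ∫ x, f θ x ∂ρ = 1) (θ : Θ) :
    ∫⁻ z : Fin n → Z, ENNReal.ofReal (∏ i, f θ (z i)) ∂(Measure.pi fun _ => ρ) = 1 := by
  have hi : Integrable (f θ) ρ := .of_integral_ne_zero (by simp [hf_int θ])
  rw [← ofReal_integral_eq_lintegral_ofReal (Integrable.fintype_prod fun _ => hi)
    (.of_forall fun z => Finset.prod_nonneg fun i _ => (hf_pos _ _).le),
    integral_fintype_prod_eq_pow, hf_int, one_pow, ENNReal.ofReal_one]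

end Posterior

/-- With `C = (η/(1-η))(2 + 2 log v)` and `c_η = (1-η)/(1+η(1-η))`, for every
`b > 0` and `n ≥ 2`,
`Π( (θ*,Z^n) : δ̄_n(θ*,Z^n) ≥ C((log v) n^{-b c_η} + 2b (log n)/n) )
  ≤ 2 (Σ_θ π(θ)^η) n^{-b c_η}`. -/
theorem bayesian_expected_gap_explicit_bound
    {Z : Type*} [MeasurableSpace Z] (ρ : Measure Z) [SigmaFinite ρ]
    {Θ : Type*} [Countable Θ]
    (f : Θ → Z → ℝ) (hf_meas : ∀ θ, Measurable (f θ))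
    (hf_pos : ∀ θ x, 0 < f θ x)
    (hf_int : ∀ θ, ∫ x, f θ x ∂ρ = 1)
    (π : Θ → ℝ) (hπ_pos : ∀ θ, 0 < π θ) (hπ_sum : ∑' θ, π θ = 1)
    (v : ℝ) (hv : 1 < v)
    (hratio : ∀ (x : Z) (θ θ' : Θ), f θ x ≤ v * f θ' x)
    (η : ℝ) (hη₁ : 1 / 2 ≤ η) (hη₂ : η < 1)
    (hsum : Summable fun θ => π θ ^ η)
    (b : ℝ) (hb : 0 < b) (n : ℕ) (hn : 2 ≤ n) :
    jointProb ρ π f n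
        (fun θstar =>
          {z | (η / (1 - η)) * (2 + 2 * Real.log v) *
              (Real.log v * (n : ℝ) ^ (-(b * ((1 - η) / (1 + η * (1 - η))))) +
                2 * b * Real.log n / n) ≤ deltaBar ρ π f θstar z})
      ≤ ENNReal.ofReal
          (2 * (∑' θ, π θ ^ η) *
            (n : ℝ) ^ (-(b * ((1 - η) / (1 + η * (1 - η)))))) := by
  have hπ : Summable π := by
    by_contra h
    rw [tsum_eq_zero_of_not_summable h] at hπ_sum
    exact zero_ne_one hπ_sum
  have hn0 : (0 : ℝ) < n := by positivity
  have hη : 0 < 1 - η := by linarith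
  have hη0 : 0 < η := by linarith
  set D := 1 + η * (1 - η) with hD
  have hD0 : 0 < D := by positivity
  set T := (n : ℝ) ^ (-(b * ((1 - η) / D))) with hT
  have hT0 : 0 < T := by positivity
  set S := ∑' θ, π θ ^ η with hS
  have hS0 : 0 ≤ S := tsum_nonneg fun θ => Real.rpow_nonneg (hπ_pos θ).le _
  have hterm : ∀ θ, 0 ≤ T * (π θ ^ η + π θ * S) := fun θ => by
    have := hπ_pos θ
    positivity
  calc _ ≤ ∑' θ, ENNReal.ofReal (T * (π θ ^ η + π θ * S)) :=
        ENNReal.tsum_le_tsum fun θs => ?_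
    _ = ENNReal.ofReal (2 * S * T) := by
      rw [← ENNReal.ofReal_tsum_of_nonneg hterm
        ((hsum.add (hπ.mul_right S)).mul_left T), tsum_mul_left,
        hsum.tsum_add (hπ.mul_right S), tsum_mul_right, hπ_sum]
      congr 1
      ring
  have hs := hπ_pos θs
  set τ := (n : ℝ) ^ (-(b / D)) with hτ
  have hτ0 : 0 < τ := by positivity
  rcases lt_or_ge (π θs) τ with hlt | hge
  · refine (mul_le_mul_right (measure_mono (Set.subset_univ _)) _).trans ?_
    rw [withDensity_apply _ .univ, setLIntegral_univ, lintegral_prod_density hf_pos hf_int,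
      mul_one]
    refine ENNReal.ofReal_le_ofReal ?_
    have h1 : π θs = π θs ^ η * π θs ^ (1 - η) := by
      rw [← Real.rpow_add hs, add_sub_cancel, Real.rpow_one]
    have h2 : π θs ^ (1 - η) ≤ T := by
      refine (Real.rpow_le_rpow hs.le hlt.le hη.le).trans (le_of_eq ?_)
      rw [hτ, ← Real.rpow_mul hn0.le, hT]
      congr 1
      ring
    have h3 := mul_le_mul_of_nonneg_left h2 (Real.rpow_nonneg hs.le η)
    have h4 : 0 ≤ T * (π θs * S) := by positivity
    linarith
  · have hB : 0 ≤ (n : ℝ) ^ (-b) := by positivity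
    refine (mul_le_mul_right ((measure_mono fun z hz =>
      mass_gt_of_deltaBar_ge hf_meas hf_pos hf_int hπ_pos hπ hv hratio hη₁ hη₂ hb hT0 hn z θs
        hz).trans (measure_mass_ge_le hf_meas hf_pos hf_int hπ_pos hπ hratio hη0.le hη₂.le hsum θs
          hT0 hB fun θ hθ => hθ)) _).trans ?_
    rw [← ENNReal.ofReal_mul hs.le]
    refine ENNReal.ofReal_le_ofReal ?_
    have h1 : π θs ^ (-η) ≤ τ ^ (-η) :=
      Real.rpow_le_rpow_of_nonpos hτ0 hge (by linarith)
    have h2 : T ^ (-η) * τ ^ (-η) * (n : ℝ) ^ (-b) = T := by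
      rw [hT, hτ, ← Real.rpow_mul hn0.le, ← Real.rpow_mul hn0.le, ← Real.rpow_add hn0,
        ← Real.rpow_add hn0]
      congr 1
      rw [hD] at hD0 ⊢
      field_simp
      ring
    have h3 : T ^ (-η) * π θs ^ (-η) * (n : ℝ) ^ (-b) ≤ T :=
      le_trans (by gcongr) h2.le
    have h4 := mul_le_mul_of_nonneg_left h3 (mul_nonneg hs.le hS0)
    have h5 : 0 ≤ T * π θs ^ η := by positivity
    linarith
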